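/- Let X be a 2-neighborly member of K̄(d), i.e., a d-dimensional simplicial complex in which every pair of vertices forms an edge and all of whose vertex links are stacked (d-1)-balls. Then for every vertex x of X, the set of facets of X containing x induces a subtree of the dual graph Λ(X) on exactly f_0(X) − d vertices, and for any two vertices x, y of X these two induced subtrees have a common vertex (i.e., some facet contains both x and y). -/

import Mathlib

variable {V : Type*} [DecidableEq V]

/-- The number of faces of the complex with facet set `F` having exactly `k` vertices
(i.e. of dimension `k - 1`). -/
def faceCount (F : Finset (Finset V)) (k : ℕ) : ℕ :=
  (F.biUnion fun σ => σ.powersetCard k).card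

/-- The vertex set of the complex with facet set `F`. -/
def vertexSet (F : Finset (Finset V)) : Finset V := F.biUnion id

/-- The dual graph of a pure `d`-dimensional complex given by its facet set `F`:
two facets are adjacent iff their intersection has `d` vertices (dimension `d-1`). -/
def dualGraph (d : ℕ) (F : Finset (Finset V)) : SimpleGraph {σ // σ ∈ F} where
  Adj σ τ := σ ≠ τ ∧ (σ.1 ∩ τ.1).card = d
  symm := ⟨fun σ τ h => ⟨h.1.symm, by rw [Finset.inter_comm]; exact h.2⟩⟩
  loopless := ⟨fun σ h => h.1 rfl⟩

/-- `IsStackedBall d F` : the pure `d`-dimensional complex with facet set `F` is a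
stacked `d`-ball, i.e. it is obtained from a single `d`-simplex by repeatedly gluing
a new `d`-simplex `σ` along a single `(d-1)`-face `τ` lying in exactly one facet of the previous complex
(so that the intersection of the old complex with the new simplex is exactly `τ̄`). -/
inductive IsStackedBall : ℕ → Finset (Finset V) → Prop
  | single (d : ℕ) (σ : Finset V) (h : σ.card = d + 1) : IsStackedBall d {σ}
  | glue (d : ℕ) (F : Finset (Finset V)) (σ τ : Finset V) :
      IsStackedBall d F → σ.card = d + 1 → σ ∉ F → τ ⊆ σ → τ.card = d →
      (∃! ρ, ρ ∈ F ∧ τ ⊆ ρ) → (∀ ρ ∈ F, ρ ∩ σ ⊆ τ) → IsStackedBall d (insert σ F)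

/-- The facet set of the link of the vertex `x` in the pure complex with facet set `F`. -/
def linkFacets (F : Finset (Finset V)) (x : V) : Finset (Finset V) :=
  (F.filter fun σ => x ∈ σ).image fun σ => σ.erase x

/-- The facet set of the boundary of a pure `d`-dimensional weak pseudomanifold with
facet set `F` : the `d`-element subsets of facets lying in exactly one facet. -/
def bdryFacets (d : ℕ) (F : Finset (Finset V)) : Finset (Finset V) :=
  (F.biUnion fun σ => σ.powersetCard d).filter fun τ => (F.filter fun σ => τ ⊆ σ).card = 1

/-- A complex (given by its facet set `S`) is a stacked `d`-sphere if it is the boundary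
of a stacked `(d+1)`-ball. -/
def IsStackedSphere (d : ℕ) (S : Finset (Finset V)) : Prop :=
  ∃ B : Finset (Finset V), IsStackedBall (d + 1) B ∧ S = bdryFacets (d + 1) B

theorem isTree_of_leaf {W : Type*} (G : SimpleGraph W) (v w : W) (hvw : G.Adj v w)
    (huniq : ∀ u, G.Adj v u → u = w) (ht : (G.induce {u | u ≠ v}).IsTree) : G.IsTree := by
  classical
  have hreach : ∀ u, G.Reachable u w := by
    intro u
    by_cases hu : u = v
    · subst hu; exact hvw.reachable
    · have := ht.connected.preconnected ⟨u, hu⟩ ⟨w, hvw.ne'⟩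
      exact this.map (SimpleGraph.Embedding.induce _).toHom
  refine ⟨?_, ?_⟩
  · have : Nonempty W := ⟨v⟩
    exact ⟨fun a b => (hreach a).trans (hreach b).symm⟩
  · intro a c hc
    by_cases hv : v ∈ c.support
    · have hc' := hc.rotate hv
      have h1 := hc'.snd_ne_penultimate
      have h2 := huniq _ ((c.rotate v hv).adj_snd hc'.not_nil)
      have h3 := huniq _ ((c.rotate v hv).adj_penultimate hc'.not_nil).symm
      exact h1 (h2.trans h3.symm)
    · have hs : ∀ x ∈ c.support, x ∈ {u | u ≠ v} := by
        rintro x hx rfl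
        exact hv hx
      have hm := SimpleGraph.Walk.map_induce c hs
      refine ht.isAcyclic (c.induce _ hs) ?_
      rw [← hm] at hc
      exact (SimpleGraph.Walk.isCycle_map_iff_of_injective
        (SimpleGraph.Embedding.induce (G := G) {u | u ≠ v}).injective).1 hc

theorem stacked_card {d : ℕ} {F : Finset (Finset V)} (h : IsStackedBall d F) :
    ∀ σ ∈ F, σ.card = d + 1 := by
  induction h with
  | single σ h => simpa using h
  | glue F σ τ hF h1 h2 h3 h4 h5 h6 ih =>
    intro ρ hρ
    rcases Finset.mem_insert.1 hρ with rfl | h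
    · exact h1
    · exact ih ρ h

theorem stacked_count {d : ℕ} {F : Finset (Finset V)} (h : IsStackedBall d F) :
    F.card + d = (vertexSet F).card := by
  induction h with
  | single σ h => simp [vertexSet, h, add_comm]
  | glue F σ τ hF h1 h2 h3 h4 h5 h6 ih =>
    obtain ⟨ρ, ⟨hρ, hτρ⟩, -⟩ := h5
    have e : vertexSet (insert σ F) = (σ \ τ) ∪ vertexSet F := by
      ext x
      simp only [vertexSet, Finset.mem_biUnion, Finset.mem_insert, id, Finset.mem_union,
        Finset.mem_sdiff]
      constructor
      · rintro ⟨a, rfl | ha, hx⟩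
        · by_cases hxt : x ∈ τ
          · exact Or.inr ⟨ρ, hρ, hτρ hxt⟩
          · exact Or.inl ⟨hx, hxt⟩
        · exact Or.inr ⟨a, ha, hx⟩
      · rintro (⟨hx, -⟩ | ⟨a, ha, hx⟩)
        · exact ⟨σ, Or.inl rfl, hx⟩
        · exact ⟨a, Or.inr ha, hx⟩
    have dj : Disjoint (σ \ τ) (vertexSet F) := by
      rw [Finset.disjoint_left]
      intro x hx hx'
      obtain ⟨a, ha, hxa⟩ := Finset.mem_biUnion.1 hx'
      rw [Finset.mem_sdiff] at hx
      exact hx.2 (h6 a ha (Finset.mem_inter.2 ⟨hxa, hx.1⟩))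
    rw [e, Finset.card_union_of_disjoint dj, Finset.card_sdiff_of_subset h3,
      Finset.card_insert_of_notMem h2, h1, h4]
    omega

theorem stacked_tree {d : ℕ} {F : Finset (Finset V)} (h : IsStackedBall d F) :
    (dualGraph d F).IsTree := by
  induction h with
  | single σ h =>
    have : Subsingleton {x // x ∈ ({σ} : Finset (Finset V))} :=
      ⟨fun a b => Subtype.ext ((Finset.mem_singleton.1 a.2).trans (Finset.mem_singleton.1 b.2).symm)⟩
    have : Nonempty {x // x ∈ ({σ} : Finset (Finset V))} := ⟨⟨σ, by simp⟩⟩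
    exact SimpleGraph.IsTree.of_subsingleton
  | glue F σ τ hF h1 h2 h3 h4 h5 h6 ih =>
    obtain ⟨ρ, ⟨hρ, hτρ⟩, hu⟩ := h5
    have key : ∀ a ∈ F, (σ ∩ a).card = d → τ ⊆ a := by
      intro a ha hc
      have hs : σ ∩ a ⊆ τ := by rw [Finset.inter_comm]; exact h6 a ha
      rw [← Finset.eq_of_subset_of_card_le hs (by omega)]
      exact Finset.inter_subset_right
    have hne : σ ≠ ρ := by rintro rfl; exact h2 hρ
    refine isTree_of_leaf _ ⟨σ, Finset.mem_insert_self _ _⟩ ⟨ρ, Finset.mem_insert_of_mem hρ⟩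
      ⟨fun h => hne (congrArg Subtype.val h), ?_⟩ ?_ ?_
    · have : σ ∩ ρ = τ := by
        apply Finset.Subset.antisymm
        · rw [Finset.inter_comm]; exact h6 ρ hρ
        · exact Finset.subset_inter h3 hτρ
      show (σ ∩ ρ).card = d
      rw [this, h4]
    · rintro ⟨a, ha⟩ ⟨hn, hc⟩
      rcases Finset.mem_insert.1 ha with rfl | ha'
      · exact absurd rfl hn
      · exact Subtype.ext (hu a ⟨ha', key a ha' hc⟩)
    · let e : dualGraph d F ≃g (dualGraph d (insert σ F)).induce
          {u | u ≠ ⟨σ, Finset.mem_insert_self _ _⟩} :=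
        { toFun := fun a => ⟨⟨a.1, Finset.mem_insert_of_mem a.2⟩, fun h =>
            h2 (by have h' : a.1 = σ := congrArg Subtype.val h
                   rw [← h']; exact a.2)⟩
          invFun := fun a => ⟨a.1.1, (Finset.mem_insert.1 a.1.2).resolve_left
            (fun h => a.2 (Subtype.ext h))⟩
          left_inv := fun a => rfl
          right_inv := fun a => rfl
          map_rel_iff' := by
            intro a b
            simp only [dualGraph, SimpleGraph.comap_adj, Function.Embedding.subtype_apply, ne_eq,
              Subtype.ext_iff, Equiv.coe_fn_mk] }
      exact e.isTree_iff.1 ih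

theorem link_tree (d : ℕ) (F : Finset (Finset V)) (x : V)
    (h : (dualGraph d (linkFacets F x)).IsTree) :
    ((dualGraph (d + 1) F).induce {σ : {σ // σ ∈ F} | x ∈ σ.1}).IsTree := by
  have hx : ∀ a ∈ linkFacets F x, x ∉ a ∧ insert x a ∈ F := by
    intro a ha
    obtain ⟨b, hb, rfl⟩ := Finset.mem_image.1 ha
    rw [Finset.mem_filter] at hb
    refine ⟨Finset.notMem_erase _ _, ?_⟩
    rw [Finset.insert_erase hb.2]
    exact hb.1
  let e : dualGraph d (linkFacets F x) ≃g
      (dualGraph (d + 1) F).induce {σ : {σ // σ ∈ F} | x ∈ σ.1} :=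
    { toFun := fun a => ⟨⟨insert x a.1, (hx a.1 a.2).2⟩, Finset.mem_insert_self _ _⟩
      invFun := fun a => ⟨a.1.1.erase x, Finset.mem_image.2
        ⟨a.1.1, Finset.mem_filter.2 ⟨a.1.2, a.2⟩, rfl⟩⟩
      left_inv := fun a => Subtype.ext (Finset.erase_insert (hx a.1 a.2).1)
      right_inv := fun a => Subtype.ext (Subtype.ext (Finset.insert_erase a.2))
      map_rel_iff' := by
        rintro ⟨a, ha⟩ ⟨b, hb⟩
        have h1 := (hx a ha).1
        have h2 := (hx b hb).1
        have h3 : (insert x a ∩ insert x b).card = (a ∩ b).card + 1 := by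
          rw [← Finset.insert_inter_distrib, Finset.card_insert_of_notMem]
          simp [h1]
        have h4 : insert x a = insert x b ↔ a = b := by
          constructor
          · intro h
            rw [← Finset.erase_insert h1, h, Finset.erase_insert h2]
          · rintro rfl; rfl
        simp only [dualGraph, SimpleGraph.comap_adj, Function.Embedding.subtype_apply,
          ne_eq, Subtype.ext_iff, Equiv.coe_fn_mk, h3, h4, Nat.add_right_cancel_iff] }
  exact e.isTree_iff.1 h

/-- Let `X` be a 2-neighborly member of `K̄(d)` : a pure `d`-dimensional
simplicial complex in which every pair of vertices lies in a common facet and all of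
whose vertex links are stacked `(d-1)`-balls. Then for every vertex `x`, the facets of
`X` containing `x` induce a subtree of the dual graph `Λ(X)` on exactly `f₀(X) - d`
vertices, and any two of these subtrees have a common vertex (some facet contains both
given vertices). -/
theorem stmt6 (d : ℕ) (F : Finset (Finset V)) (hne : F.Nonempty)
    (hpure : ∀ σ ∈ F, σ.card = d + 1)
    (hnbr : ∀ x ∈ vertexSet F, ∀ y ∈ vertexSet F, ∃ σ ∈ F, x ∈ σ ∧ y ∈ σ)
    (hlinks : ∀ x ∈ vertexSet F, IsStackedBall (d - 1) (linkFacets F x)) :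
    (∀ x ∈ vertexSet F,
        ((dualGraph d F).induce {σ : {σ // σ ∈ F} | x ∈ σ.1}).IsTree ∧
        (F.filter fun σ => x ∈ σ).card + d = (vertexSet F).card) ∧
      (∀ x ∈ vertexSet F, ∀ y ∈ vertexSet F, ∃ σ ∈ F, x ∈ σ ∧ y ∈ σ) := by
  refine ⟨?_, hnbr⟩
  intro x hx
  have hst := hlinks x hx
  obtain ⟨σ, hσ, -, hxσ⟩ : ∃ σ ∈ F, x ∈ σ ∧ x ∈ σ := hnbr x hx x hx
  obtain _ | d := d
  · exfalso
    have h1 := stacked_card hst (σ.erase x)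
      (Finset.mem_image.2 ⟨σ, Finset.mem_filter.2 ⟨hσ, hxσ⟩, rfl⟩)
    rw [Finset.card_erase_of_mem hxσ, hpure σ hσ] at h1
    simp at h1
  · rw [Nat.add_sub_cancel] at hst
    refine ⟨link_tree d F x (stacked_tree hst), ?_⟩
    have hc := stacked_count hst
    have hcard : (linkFacets F x).card = (F.filter fun σ => x ∈ σ).card := by
      apply Finset.card_image_of_injOn
      intro a ha b hb hab
      have ha' := (Finset.mem_filter.1 ha).2
      have hb' := (Finset.mem_filter.1 hb).2
      have hab' : a.erase x = b.erase x := hab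
      rw [← Finset.insert_erase ha', hab', Finset.insert_erase hb']
    have hv : vertexSet (linkFacets F x) = (vertexSet F).erase x := by
      ext y
      constructor
      · intro hy
        obtain ⟨a, ha, hya⟩ := Finset.mem_biUnion.1 hy
        obtain ⟨b, hb, rfl⟩ := Finset.mem_image.1 ha
        have hya' : y ∈ b.erase x := hya
        rw [Finset.mem_erase] at hya' ⊢
        exact ⟨hya'.1, Finset.mem_biUnion.2 ⟨b, (Finset.mem_filter.1 hb).1, hya'.2⟩⟩
      · intro hy
        rw [Finset.mem_erase] at hy
        obtain ⟨b, hb, hxb, hyb⟩ := hnbr x hx y hy.2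
        exact Finset.mem_biUnion.2 ⟨b.erase x, Finset.mem_image.2
          ⟨b, Finset.mem_filter.2 ⟨hb, hxb⟩, rfl⟩, Finset.mem_erase.2 ⟨hy.1, hyb⟩⟩
    have hpos := Finset.card_pos.2 ⟨x, hx⟩
    rw [hcard, hv, Finset.card_erase_of_mem hx] at hc
    omega
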